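/- Let g and ḡ be projectively equivalent pseudo-Riemannian metrics on an n-dimensional manifold M. Then the function I : TM → ℝ defined by I(ξ) = |det g / det ḡ|^{2/(n+1)} ḡ(ξ, ξ) is an integral of the geodesic flow of g: for every geodesic γ of g, the function t ↦ I(γ̇(t)) is constant. -/

import Mathlib

open scoped ContDiff

noncomputable section

namespace ProjGeo

/-- The partial derivative of a function on `ℝⁿ` in the `j`-th coordinate direction. -/
def pd {n : ℕ} (j : Fin n) (f : (Fin n → ℝ) → ℝ) (p : Fin n → ℝ) : ℝ :=
  fderiv ℝ f p (Pi.single j 1)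

/-- Christoffel symbols in coordinates: `Γ p i j k` represents `Γ^i_{jk}` at the point `p`. -/
abbrev Christoffel (n : ℕ) := (Fin n → ℝ) → Fin n → Fin n → Fin n → ℝ

/-- A connection is torsion-free (symmetric) if `Γ^i_{jk} = Γ^i_{kj}`. -/
def TorsionFree {n : ℕ} (Γ : Christoffel n) : Prop :=
  ∀ p i j k, Γ p i j k = Γ p i k j

/-- Smoothness of the Christoffel symbols on the open set `U`. -/
def SmoothChristoffelOn {n : ℕ} (U : Set (Fin n → ℝ)) (Γ : Christoffel n) : Prop :=
  ∀ i j k, ContDiffOn ℝ ∞ (fun p => Γ p i j k) U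

/-- `γ` is a (parameterized) geodesic of the connection `Γ` on the parameter set `I`,
staying inside `U`: it is smooth and satisfies `γ̈^i + Γ^i_{jk} γ̇^j γ̇^k = 0`. -/
def IsGeodesicOn {n : ℕ} (U : Set (Fin n → ℝ)) (Γ : Christoffel n)
    (γ : ℝ → Fin n → ℝ) (I : Set ℝ) : Prop :=
  (∀ t ∈ I, γ t ∈ U) ∧ (∀ i, ContDiffOn ℝ ∞ (fun t => γ t i) I) ∧
  ∀ t ∈ I, ∀ i,
    deriv (fun s => deriv (fun u => γ u i) s) t
      + ∑ j, ∑ k, Γ (γ t) i j k * deriv (fun u => γ u j) t * deriv (fun u => γ u k) t = 0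

/-- `h` is a smooth regular reparameterisation defined on `J` and mapping `J` bijectively
onto `I`. -/
def IsReparam (I J : Set ℝ) (h : ℝ → ℝ) : Prop :=
  ContDiffOn ℝ ∞ h J ∧ (∀ t ∈ J, deriv h t ≠ 0) ∧ Set.BijOn h J I

/-- Two connections are projectively equivalent on `U`: each geodesic of the one is, after a
suitable reparameterisation, a geodesic of the other, and vice versa. -/
def ProjEquivOn {n : ℕ} (U : Set (Fin n → ℝ)) (Γ Γ' : Christoffel n) : Prop :=
  (∀ γ I, IsOpen I → IsGeodesicOn U Γ γ I →
    ∃ h J, IsOpen J ∧ IsReparam I J h ∧ IsGeodesicOn U Γ' (fun t => γ (h t)) J) ∧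
  (∀ γ I, IsOpen I → IsGeodesicOn U Γ' γ I →
    ∃ h J, IsOpen J ∧ IsReparam I J h ∧ IsGeodesicOn U Γ (fun t => γ (h t)) J)

/-- `Γ'` is obtained from `Γ` by the projective change associated with the 1-form `φ`:
`Γ'^i_{jk} = Γ^i_{jk} + φ_k δ^i_j + φ_j δ^i_k` on `U`. -/
def ProjChange {n : ℕ} (Γ Γ' : Christoffel n) (φ : (Fin n → ℝ) → Fin n → ℝ)
    (U : Set (Fin n → ℝ)) : Prop :=
  ∀ p ∈ U, ∀ i j k, Γ' p i j k =
    Γ p i j k + (if i = j then φ p k else 0) + (if i = k then φ p j else 0)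

end ProjGeo

namespace ProjGeo

/-- A (pseudo-Riemannian) metric on `U` in coordinates: a smooth symmetric nondegenerate
matrix-valued function. -/
def MetricOn {n : ℕ} (U : Set (Fin n → ℝ))
    (g : (Fin n → ℝ) → Matrix (Fin n) (Fin n) ℝ) : Prop :=
  (∀ i j, ContDiffOn ℝ ∞ (fun p => g p i j) U) ∧
  (∀ p ∈ U, ∀ i j, g p i j = g p j i) ∧
  (∀ p ∈ U, (g p).det ≠ 0)

/-- A Riemannian (positive definite) metric on `U` in coordinates. -/
def RiemannianOn {n : ℕ} (U : Set (Fin n → ℝ))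
    (g : (Fin n → ℝ) → Matrix (Fin n) (Fin n) ℝ) : Prop :=
  MetricOn U g ∧
  ∀ p ∈ U, ∀ v : Fin n → ℝ, v ≠ 0 → 0 < ∑ i, ∑ j, g p i j * v i * v j

/-- The Christoffel symbols of the Levi-Civita connection of the metric `g`:
`Γ^i_{jk} = ½ g^{is} (∂_j g_{sk} + ∂_k g_{sj} − ∂_s g_{jk})`. -/
def LeviCivita {n : ℕ} (g : (Fin n → ℝ) → Matrix (Fin n) (Fin n) ℝ) : Christoffel n :=
  fun p i j k => (1 / 2) * ∑ s, (g p)⁻¹ i s *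
    (pd j (fun q => g q s k) p + pd k (fun q => g q s j) p - pd s (fun q => g q j k) p)

end ProjGeo

namespace ProjGeo

/-- Jacobi's formula for the derivative of a determinant along a curve of matrices. -/
theorem hasDerivAt_det {n : ℕ} {A : ℝ → Matrix (Fin n) (Fin n) ℝ}
    {A' : Matrix (Fin n) (Fin n) ℝ} {t : ℝ}
    (hA : ∀ i j, HasDerivAt (fun s => A s i j) (A' i j) t) :
    HasDerivAt (fun s => (A s).det) (∑ i, ∑ j, A' i j * (A t).adjugate j i) t := by
  let f : ContinuousMultilinearMap ℝ (fun _ : Fin n => Fin n → ℝ) ℝ :=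
    { toMultilinearMap := (Matrix.detRowAlternating (n := Fin n) (R := ℝ)).toMultilinearMap
      cont := Continuous.matrix_det (A := fun M : Matrix (Fin n) (Fin n) ℝ => M) continuous_id }
  have hrow : HasDerivAt (fun s => (fun i j => A s i j : Fin n → Fin n → ℝ))
      (fun i j => A' i j) t :=
    hasDerivAt_pi.2 fun i => hasDerivAt_pi.2 fun j => hA i j
  have h := (f.hasFDerivAt (x := fun i j => A t i j)).comp_hasDerivAt t hrow
  refine h.congr_deriv ?_
  rw [ContinuousMultilinearMap.linearDeriv_apply]
  refine Finset.sum_congr rfl fun i _ => ?_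
  have h1 : f (Function.update (fun i j => A t i j) i (fun j => A' i j))
      = ((A t).updateRow i (A' i)).det := rfl
  rw [h1, ← Matrix.cramer_transpose_apply, Matrix.cramer_eq_adjugate_mulVec,
    ← Matrix.adjugate_transpose, Matrix.mulVec, dotProduct]
  exact Finset.sum_congr rfl fun j _ => by rw [Matrix.transpose_apply, mul_comm]

theorem contDiffOn_det {E : Type*} [NormedAddCommGroup E] [NormedSpace ℝ E] {n : ℕ}
    {A : E → Matrix (Fin n) (Fin n) ℝ} {s : Set E} {m : WithTop ℕ∞}
    (hA : ∀ i j, ContDiffOn ℝ m (fun p => A p i j) s) :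
    ContDiffOn ℝ m (fun p => (A p).det) s := by
  simp only [Matrix.det_apply']
  exact ContDiffOn.sum fun σ _ => contDiffOn_const.mul (contDiffOn_prod fun i _ => hA _ _)

theorem contDiffOn_inv_apply {E : Type*} [NormedAddCommGroup E] [NormedSpace ℝ E] {n : ℕ}
    {A : E → Matrix (Fin n) (Fin n) ℝ} {s : Set E} {m : WithTop ℕ∞}
    (hA : ∀ i j, ContDiffOn ℝ m (fun p => A p i j) s) (hdet : ∀ p ∈ s, (A p).det ≠ 0)
    (i j : Fin n) : ContDiffOn ℝ m (fun p => (A p)⁻¹ i j) s := by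
  simp only [Matrix.inv_def, Ring.inverse_eq_inv', Matrix.smul_apply, smul_eq_mul,
    Matrix.adjugate_apply]
  refine ((contDiffOn_det hA).inv hdet).mul (contDiffOn_det fun k l => ?_)
  by_cases h : k = j
  · subst h
    simpa only [Matrix.updateRow_self] using contDiffOn_const
  · simpa only [Matrix.updateRow_ne h] using hA k l

theorem contDiffOn_pd {n : ℕ} {U : Set (Fin n → ℝ)} (hU : IsOpen U) {f : (Fin n → ℝ) → ℝ}
    (hf : ContDiffOn ℝ ∞ f U) (j : Fin n) : ContDiffOn ℝ ∞ (fun p => pd j f p) U :=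
  (hf.fderiv_of_isOpen hU (by simp)).clm_apply contDiffOn_const

theorem smoothChristoffelOn_leviCivita {n : ℕ} {U : Set (Fin n → ℝ)} (hU : IsOpen U)
    {g : (Fin n → ℝ) → Matrix (Fin n) (Fin n) ℝ} (hg : MetricOn U g) :
    SmoothChristoffelOn U (LeviCivita g) := by
  intro i j k
  unfold LeviCivita
  exact contDiffOn_const.mul <| ContDiffOn.sum fun s _ =>
    (contDiffOn_inv_apply hg.1 hg.2.2 i s).mul <|
      ((contDiffOn_pd hU (hg.1 s k) j).add (contDiffOn_pd hU (hg.1 s j) k)).sub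
        (contDiffOn_pd hU (hg.1 j k) s)

/-- Integral curves of a smooth vector field are smooth. -/
theorem contDiffOn_of_hasDerivAt_comp {E : Type*} [NormedAddCommGroup E] [NormedSpace ℝ E]
    {F : E → E} {W : Set E} (hF : ContDiffOn ℝ ∞ F W) {x : ℝ → E} {J : Set ℝ} (hJ : IsOpen J)
    (hW : ∀ t ∈ J, x t ∈ W) (hx : ∀ t ∈ J, HasDerivAt x (F (x t)) t) :
    ContDiffOn ℝ ∞ x J := by
  have hd : DifferentiableOn ℝ x J := fun t ht =>
    (hx t ht).differentiableAt.differentiableWithinAt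
  refine contDiffOn_infty.2 fun m => ?_
  induction m with
  | zero => exact contDiffOn_zero.2 hd.continuousOn
  | succ m ih =>
    push_cast
    rw [contDiffOn_succ_iff_deriv_of_isOpen hJ]
    refine ⟨hd, by simp, ?_⟩
    exact ((hF.of_le (by exact_mod_cast le_top)).comp ih hW).congr fun t ht => (hx t ht).deriv

/-- Through every point, in every direction, there is a geodesic of a smooth connection. -/
theorem exists_isGeodesicOn {n : ℕ} {U : Set (Fin n → ℝ)} (hU : IsOpen U)
    {Γ : Christoffel n} (hΓ : SmoothChristoffelOn U Γ) {p : Fin n → ℝ} (hp : p ∈ U)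
    (v : Fin n → ℝ) :
    ∃ (γ : ℝ → Fin n → ℝ) (I : Set ℝ), IsOpen I ∧ (0 : ℝ) ∈ I ∧ IsGeodesicOn U Γ γ I ∧
      γ 0 = p ∧ ∀ i, deriv (fun s => γ s i) 0 = v i := by
  let F : (Fin n → ℝ) × (Fin n → ℝ) → (Fin n → ℝ) × (Fin n → ℝ) := fun y =>
    (y.2, fun i => -∑ j, ∑ k, Γ y.1 i j k * y.2 j * y.2 k)
  have hWo : IsOpen (Prod.fst ⁻¹' U : Set ((Fin n → ℝ) × (Fin n → ℝ))) :=
    hU.preimage continuous_fst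
  have hcoord : ∀ j, ContDiffOn ℝ ∞ (fun y : (Fin n → ℝ) × (Fin n → ℝ) => y.2 j)
      (Prod.fst ⁻¹' U) := fun j => by fun_prop
  have hF : ContDiffOn ℝ ∞ F (Prod.fst ⁻¹' U) := by
    refine contDiffOn_snd.prodMk (contDiffOn_pi.2 fun i => ContDiffOn.neg <|
      ContDiffOn.sum fun j _ => ContDiffOn.sum fun k _ => ?_)
    exact ((((hΓ i j k).comp contDiffOn_fst fun y hy => hy).mul (hcoord j)).mul (hcoord k))
  have hFat : ContDiffAt ℝ 1 F (p, v) :=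
    (hF.contDiffAt (hWo.mem_nhds hp)).of_le (by exact_mod_cast le_top)
  obtain ⟨x, hx0, ε, hε, hx⟩ :=
    hFat.exists_forall_mem_closedBall_exists_eq_forall_mem_Ioo_hasDerivAt₀ 0
  have hcont : ContinuousOn x (Set.Ioo (0 - ε) (0 + ε)) := fun t ht =>
    (hx t ht).continuousAt.continuousWithinAt
  let I : Set ℝ := Set.Ioo (0 - ε) (0 + ε) ∩ x ⁻¹' (Prod.fst ⁻¹' U)
  have hIo : IsOpen I := hcont.isOpen_inter_preimage isOpen_Ioo hWo
  have h0 : (0 : ℝ) ∈ I := by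
    refine ⟨by simp [hε], ?_⟩
    simpa [hx0] using hp
  have hsm : ContDiffOn ℝ ∞ x I :=
    contDiffOn_of_hasDerivAt_comp hF hIo (fun t ht => ht.2) fun t ht => hx t ht.1
  have h1 : ∀ t ∈ I, ∀ i, HasDerivAt (fun s => (x s).1 i) ((x t).2 i) t := fun t ht i =>
    hasDerivAt_pi.1 (hx t ht.1).fst i
  have h2 : ∀ t ∈ I, ∀ i, HasDerivAt (fun s => (x s).2 i)
      (-∑ j, ∑ k, Γ (x t).1 i j k * (x t).2 j * (x t).2 k) t := fun t ht i =>
    hasDerivAt_pi.1 (hx t ht.1).snd i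
  refine ⟨fun t => (x t).1, I, hIo, h0, ⟨fun t ht => ht.2, fun i => ?_, fun t ht i => ?_⟩,
    by simp [hx0], fun i => ?_⟩
  · exact contDiffOn_pi.1 hsm.fst i
  · have he : (fun s => deriv (fun u => (x u).1 i) s) =ᶠ[nhds t] fun s => (x s).2 i := by
      filter_upwards [hIo.mem_nhds ht] with s hs using (h1 s hs i).deriv
    rw [he.deriv_eq, (h2 t ht i).deriv]
    simp only [(h1 t ht _).deriv]
    exact neg_add_cancel _
  · rw [(h1 0 h0 i).deriv, hx0]

/-- If the geodesics of `Γ` are, up to reparameterisation, geodesics of `Γ'`, then the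
difference tensor maps `(v, v)` to a multiple of `v`. -/
theorem exists_difference_eq_smul {n : ℕ} {U : Set (Fin n → ℝ)} (hU : IsOpen U)
    {Γ Γ' : Christoffel n} (hΓ : SmoothChristoffelOn U Γ) (hproj : ProjEquivOn U Γ Γ')
    {p : Fin n → ℝ} (hp : p ∈ U) (v : Fin n → ℝ) :
    ∃ c : ℝ, ∀ i, ∑ j, ∑ k, (Γ' p i j k - Γ p i j k) * v j * v k = c * v i := by
  obtain ⟨γ, I, hI, h0, hγ, rfl, hv⟩ := exists_isGeodesicOn hU hΓ hp v
  obtain ⟨h, J, hJ, ⟨hh, hne, hbij⟩, hγ'⟩ := hproj.1 γ I hI hγ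
  obtain ⟨t, ht, hht⟩ := hbij.surjOn h0
  have hd : ∀ s ∈ J, HasDerivAt h (deriv h s) s := fun s hs =>
    ((hh.differentiableOn (by simp)).differentiableAt (hJ.mem_nhds hs)).hasDerivAt
  have hdd : HasDerivAt (deriv h) (deriv (deriv h) t) t :=
    (((hh.deriv_of_isOpen hJ (m := ∞) (by simp)).differentiableOn (by simp)).differentiableAt
      (hJ.mem_nhds ht)).hasDerivAt
  have hc : ∀ i, ∀ s ∈ I, HasDerivAt (fun u => γ u i) (deriv (fun u => γ u i) s) s :=
    fun i s hs => (((hγ.2.1 i).differentiableOn (by simp)).differentiableAt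
      (hI.mem_nhds hs)).hasDerivAt
  have hcc : ∀ i, HasDerivAt (fun s => deriv (fun u => γ u i) s)
      (deriv (fun s => deriv (fun u => γ u i) s) (h t)) (h t) := fun i =>
    ((((hγ.2.1 i).deriv_of_isOpen hI (m := ∞) (by simp)).differentiableOn
      (by simp)).differentiableAt (hI.mem_nhds (hbij.mapsTo ht))).hasDerivAt
  have hcomp : ∀ i, ∀ s ∈ J, deriv (fun u => γ (h u) i) s
      = deriv (fun u => γ u i) (h s) * deriv h s := fun i s hs =>
    ((hc i _ (hbij.mapsTo hs)).comp s (hd s hs)).deriv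
  have hcomp2 : ∀ i, deriv (fun s => deriv (fun u => γ (h u) i) s) t
      = deriv (fun s => deriv (fun u => γ u i) s) (h t) * deriv h t * deriv h t
        + deriv (fun u => γ u i) (h t) * deriv (deriv h) t := fun i => by
    have he : (fun s => deriv (fun u => γ (h u) i) s) =ᶠ[nhds t]
        fun s => deriv (fun u => γ u i) (h s) * deriv h s := by
      filter_upwards [hJ.mem_nhds ht] with s hs using hcomp i s hs
    rw [he.deriv_eq]
    exact (((hcc i).comp t (hd t ht)).mul hdd).deriv
  refine ⟨-(deriv (deriv h) t / (deriv h t) ^ 2), fun i => ?_⟩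
  have e1 := hγ.2.2 0 h0 i
  have e2 := hγ'.2.2 t ht i
  simp only [hcomp _ t ht, hcomp2, hht, hv] at e1 e2
  have e3 : ∑ j, ∑ k, Γ' (γ 0) i j k * (v j * deriv h t) * (v k * deriv h t)
      = (∑ j, ∑ k, Γ' (γ 0) i j k * v j * v k) * deriv h t ^ 2 := by
    simp only [Finset.sum_mul]
    exact Finset.sum_congr rfl fun j _ => Finset.sum_congr rfl fun k _ => by ring
  rw [e3] at e2
  simp only [sub_mul, Finset.sum_sub_distrib]
  have hn := hne t ht
  field_simp
  linear_combination e2 - deriv h t ^ 2 * e1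

/-- A symmetric bilinear map `T` with `T(v, v)` always proportional to `v` is of the form
`T(v, w) = φ(v) w + φ(w) v`. -/
theorem exists_eq_of_forall_apply_self_eq_smul {n : ℕ} {T : Fin n → Fin n → Fin n → ℝ}
    (hsymm : ∀ i j k, T i j k = T i k j)
    (hT : ∀ v : Fin n → ℝ, ∃ c : ℝ, ∀ i, ∑ j, ∑ k, T i j k * v j * v k = c * v i) :
    ∃ φ : Fin n → ℝ, ∀ i j k, T i j k = (if i = j then φ k else 0) + (if i = k then φ j else 0) := by
  have key : ∀ (a b : Fin n) (s : ℝ), ∃ c : ℝ, ∀ i,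
      T i a a + 2 * s * T i a b + s ^ 2 * T i b b
        = c * ((if i = a then 1 else 0) + s * (if i = b then 1 else 0)) := by
    intro a b s
    obtain ⟨c, hc⟩ := hT fun i => (if i = a then 1 else 0) + s * (if i = b then 1 else 0)
    refine ⟨c, fun i => ?_⟩
    rw [← hc i]
    simp only [mul_add, add_mul, Finset.sum_add_distrib, mul_ite, ite_mul, mul_one, mul_zero,
      zero_mul, Finset.sum_ite_eq', Finset.mem_univ, if_true]
    rw [hsymm i b a]
    ring
  have hdiag : ∀ i a, i ≠ a → T i a a = 0 := by
    intro i a hia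
    obtain ⟨c, hc⟩ := key a a 0
    simpa [hia] using hc i
  have hoff : ∀ i a b, i ≠ a → i ≠ b → T i a b = 0 := by
    intro i a b hia hib
    obtain ⟨c, hc⟩ := key a b 1
    simpa [hia, hib, hdiag] using hc i
  have hmix : ∀ a b, a ≠ b → T b a b = T a a a / 2 := by
    intro a b hab
    obtain ⟨c, hc⟩ := key a b 1
    obtain ⟨d, hd⟩ := key a b (-1)
    have h1 := hc a
    have h2 := hc b
    have h3 := hd a
    have h4 := hd b
    simp [hab, hab.symm, hdiag] at h1 h2 h3 h4
    linarith
  refine ⟨fun k => T k k k / 2, fun i j k => ?_⟩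
  by_cases hij : i = j
  · subst hij
    by_cases hik : i = k
    · subst hik; simp
    · rw [hsymm, hmix k i (Ne.symm hik)]; simp [hik]
  · by_cases hik : i = k
    · subst hik; rw [hmix j i (Ne.symm hij)]; simp [hij]
    · rw [hoff i j k hij hik]; simp [hij, hik]

theorem pd_symm {n : ℕ} {U : Set (Fin n → ℝ)} (hU : IsOpen U)
    {g : (Fin n → ℝ) → Matrix (Fin n) (Fin n) ℝ} (hg : MetricOn U g)
    {p : Fin n → ℝ} (hp : p ∈ U) (k i j : Fin n) :
    pd k (fun q => g q i j) p = pd k (fun q => g q j i) p := by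
  have he : (fun q => g q i j) =ᶠ[nhds p] fun q => g q j i := by
    filter_upwards [hU.mem_nhds hp] with q hq using hg.2.1 q hq i j
  rw [pd, pd, he.fderiv_eq]

theorem leviCivita_symm {n : ℕ} {U : Set (Fin n → ℝ)} (hU : IsOpen U)
    {g : (Fin n → ℝ) → Matrix (Fin n) (Fin n) ℝ} (hg : MetricOn U g)
    {p : Fin n → ℝ} (hp : p ∈ U) (i j k : Fin n) :
    LeviCivita g p i j k = LeviCivita g p i k j := by
  unfold LeviCivita
  congr 1
  refine Finset.sum_congr rfl fun s _ => ?_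
  rw [pd_symm hU hg hp s j k]
  ring

/-- Lowering the upper index of the Levi-Civita Christoffel symbols. -/
theorem sum_mul_leviCivita {n : ℕ} {U : Set (Fin n → ℝ)}
    {g : (Fin n → ℝ) → Matrix (Fin n) (Fin n) ℝ} (hg : MetricOn U g)
    {p : Fin n → ℝ} (hp : p ∈ U) (l j k : Fin n) :
    ∑ i, g p l i * LeviCivita g p i j k = (1 / 2) *
      (pd j (fun q => g q l k) p + pd k (fun q => g q l j) p - pd l (fun q => g q j k) p) := by
  have h : ∀ w : Fin n → ℝ, ∑ i, g p l i * ((1 / 2) * ∑ s, (g p)⁻¹ i s * w s)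
      = (1 / 2) * w l := fun w => by
    have h1 : (g p).mulVec ((g p)⁻¹.mulVec w) l = w l := by
      rw [Matrix.mulVec_mulVec, Matrix.mul_nonsing_inv _ (isUnit_iff_ne_zero.2 (hg.2.2 p hp)),
        Matrix.one_mulVec]
    rw [← h1]
    simp only [Matrix.mulVec, dotProduct, Finset.mul_sum]
    exact Finset.sum_congr rfl fun i _ => Finset.sum_congr rfl fun s _ => by ring
  exact h _

/-- The contraction `Γ^i_{ik}` is half the trace of `g⁻¹ ∂_k g`. -/
theorem sum_leviCivita {n : ℕ} {U : Set (Fin n → ℝ)} (hU : IsOpen U)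
    {g : (Fin n → ℝ) → Matrix (Fin n) (Fin n) ℝ} (hg : MetricOn U g)
    {p : Fin n → ℝ} (hp : p ∈ U) (k : Fin n) :
    ∑ i, LeviCivita g p i i k =
      (1 / 2) * ∑ i, ∑ j, pd k (fun q => g q i j) p * (g p)⁻¹ j i := by
  have hsymm : (g p).transpose = g p := Matrix.ext fun i j => hg.2.1 p hp j i
  have hinv : ∀ i s, (g p)⁻¹ i s = (g p)⁻¹ s i := fun i s => by
    conv_lhs => rw [← hsymm, ← Matrix.transpose_nonsing_inv, Matrix.transpose_apply]
  have hswap : ∑ i, ∑ s, (g p)⁻¹ i s * pd i (fun q => g q s k) p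
      = ∑ i, ∑ s, (g p)⁻¹ i s * pd s (fun q => g q i k) p := by
    rw [Finset.sum_comm]
    exact Finset.sum_congr rfl fun i _ => Finset.sum_congr rfl fun s _ => by rw [hinv]
  simp only [LeviCivita, ← Finset.mul_sum, mul_add, mul_sub, Finset.sum_add_distrib,
    Finset.sum_sub_distrib, hswap]
  rw [Finset.sum_comm (f := fun i j => pd k (fun q => g q i j) p * (g p)⁻¹ j i)]
  simp only [pd_symm hU hg hp k, mul_comm]
  ring

theorem hasDerivAt_comp_curve {n : ℕ} {U : Set (Fin n → ℝ)} (hU : IsOpen U)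
    {f : (Fin n → ℝ) → ℝ} (hf : ContDiffOn ℝ ∞ f U) {γ : ℝ → Fin n → ℝ} {t : ℝ}
    (ht : γ t ∈ U) {v : Fin n → ℝ} (hγ : ∀ i, HasDerivAt (fun s => γ s i) (v i) t) :
    HasDerivAt (fun s => f (γ s)) (∑ k, pd k f (γ t) * v k) t := by
  have h1 : HasFDerivAt f (fderiv ℝ f (γ t)) (γ t) :=
    ((hf.differentiableOn (by simp)).differentiableAt (hU.mem_nhds ht)).hasFDerivAt
  refine (h1.comp_hasDerivAt t (hasDerivAt_pi.2 hγ)).congr_deriv ?_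
  conv_lhs => rw [← Finset.univ_sum_single v, map_sum]
  refine Finset.sum_congr rfl fun k _ => ?_
  have h2 : (Pi.single k (v k) : Fin n → ℝ) = v k • Pi.single k 1 := by
    rw [← Pi.single_smul, smul_eq_mul, mul_one]
  rw [pd, h2, map_smul, smul_eq_mul, mul_comm]

/-- The derivative of `det g` along a curve, in terms of the contracted Christoffel symbols. -/
theorem hasDerivAt_det_metric {n : ℕ} {U : Set (Fin n → ℝ)} (hU : IsOpen U)
    {g : (Fin n → ℝ) → Matrix (Fin n) (Fin n) ℝ} (hg : MetricOn U g)
    {γ : ℝ → Fin n → ℝ} {t : ℝ} (ht : γ t ∈ U) {v : Fin n → ℝ}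
    (hγ : ∀ i, HasDerivAt (fun s => γ s i) (v i) t) :
    HasDerivAt (fun s => (g (γ s)).det)
      (2 * (g (γ t)).det * ∑ k, (∑ i, LeviCivita g (γ t) i i k) * v k) t := by
  have h := hasDerivAt_det (A := fun s => g (γ s))
    (A' := fun i j => ∑ k, pd k (fun q => g q i j) (γ t) * v k)
    fun i j => hasDerivAt_comp_curve hU (hg.1 i j) ht hγ
  refine h.congr_deriv ?_
  have hadj : ∀ i j, (g (γ t)).adjugate i j = (g (γ t)).det * (g (γ t))⁻¹ i j := fun i j => by
    rw [Matrix.inv_def, Ring.inverse_eq_inv', Matrix.smul_apply, smul_eq_mul,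
      mul_inv_cancel_left₀ (hg.2.2 _ ht)]
  simp only [sum_leviCivita hU hg ht, hadj, Finset.mul_sum, Finset.sum_mul]
  conv_rhs => rw [Finset.sum_comm]
  refine Finset.sum_congr rfl fun i _ => ?_
  conv_rhs => rw [Finset.sum_comm]
  exact Finset.sum_congr rfl fun j _ => Finset.sum_congr rfl fun k _ => by ring

/-- If `a` is the defect of a curve `γ` from being a geodesic of `g`, i.e. its covariant
acceleration, then the derivative of `g(γ̇, γ̇)` is `2 g(a, γ̇)`. -/
theorem hasDerivAt_metric_apply_self {n : ℕ} {U : Set (Fin n → ℝ)} (hU : IsOpen U)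
    {g : (Fin n → ℝ) → Matrix (Fin n) (Fin n) ℝ} (hg : MetricOn U g)
    {γ v : ℝ → Fin n → ℝ} {t : ℝ} (ht : γ t ∈ U)
    (hγ : ∀ i, HasDerivAt (fun s => γ s i) (v t i) t) {a : Fin n → ℝ}
    (hv : ∀ i, HasDerivAt (fun s => v s i)
      (a i - ∑ j, ∑ k, LeviCivita g (γ t) i j k * v t j * v t k) t) :
    HasDerivAt (fun s => ∑ i, ∑ j, g (γ s) i j * v s i * v s j)
      (2 * ∑ i, ∑ j, g (γ t) i j * a i * v t j) t := by
  have h := HasDerivAt.fun_sum (u := Finset.univ) fun i _ =>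
    HasDerivAt.fun_sum (u := Finset.univ) fun j _ =>
      ((hasDerivAt_comp_curve hU (hg.1 i j) ht hγ).mul (hv i)).mul (hv j)
  refine h.congr_deriv ?_
  set w := v t
  set G : Fin n → ℝ := fun i => ∑ j, ∑ k, LeviCivita g (γ t) i j k * w j * w k with hG
  set S : ℝ := ∑ i, ∑ j, ∑ k, pd k (fun q => g q i j) (γ t) * w k * w i * w j with hS
  have hB : ∀ x y : Fin n → ℝ, ∑ i, ∑ j, g (γ t) i j * x i * y j
      = ∑ i, ∑ j, g (γ t) i j * y i * x j := fun x y => by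
    rw [Finset.sum_comm]
    exact Finset.sum_congr rfl fun i _ => Finset.sum_congr rfl fun j _ => by
      rw [hg.2.1 _ ht j i]; ring
  have hGS : ∑ i, ∑ j, g (γ t) i j * w i * G j = (1 / 2) * S := by
    have h1 : ∀ i, ∑ j, g (γ t) i j * w i * G j = ∑ j, ∑ k, (1 / 2) *
        (pd j (fun q => g q i k) (γ t) + pd k (fun q => g q i j) (γ t)
          - pd i (fun q => g q j k) (γ t)) * w i * w j * w k := fun i => by
      simp only [← sum_mul_leviCivita hg ht, hG, Finset.mul_sum, Finset.sum_mul]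
      rw [Finset.sum_comm]
      refine Finset.sum_congr rfl fun j _ => ?_
      rw [Finset.sum_comm]
      exact Finset.sum_congr rfl fun k _ => Finset.sum_congr rfl fun l _ => by ring
    have h2 : ∑ i, ∑ j, ∑ k, pd j (fun q => g q i k) (γ t) * w i * w j * w k = S := by
      refine Finset.sum_congr rfl fun i _ => ?_
      rw [Finset.sum_comm]
      exact Finset.sum_congr rfl fun j _ => Finset.sum_congr rfl fun k _ => by ring
    have h3 : ∑ i, ∑ j, ∑ k, pd k (fun q => g q i j) (γ t) * w i * w j * w k = S :=
      Finset.sum_congr rfl fun i _ => Finset.sum_congr rfl fun j _ =>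
        Finset.sum_congr rfl fun k _ => by ring
    have h4 : ∑ i, ∑ j, ∑ k, pd i (fun q => g q j k) (γ t) * w i * w j * w k = S := by
      rw [Finset.sum_comm]
      refine Finset.sum_congr rfl fun i _ => ?_
      rw [Finset.sum_comm]
    simp only [h1]
    simp only [mul_assoc, ← Finset.mul_sum]
    simp only [← mul_assoc, add_mul, sub_mul, Finset.sum_add_distrib, Finset.sum_sub_distrib, h2,
      h3, h4]
    ring
  calc _ = S + (∑ i, ∑ j, g (γ t) i j * a i * w j) + (∑ i, ∑ j, g (γ t) i j * w i * a j)
        - (∑ i, ∑ j, g (γ t) i j * G i * w j) - ∑ i, ∑ j, g (γ t) i j * w i * G j := by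
        simp only [hS, ← Finset.sum_add_distrib, ← Finset.sum_sub_distrib]
        refine Finset.sum_congr rfl fun i _ => Finset.sum_congr rfl fun j _ => ?_
        simp only [← Finset.sum_mul, Pi.mul_apply, hG]
        ring
    _ = _ := by
        rw [hB w a, hB G w, hGS]
        ring

/-- A metric with projectively equivalent Levi-Civita connection differs from the given one by
a one-form. -/
theorem exists_leviCivita_sub_eq {n : ℕ} {U : Set (Fin n → ℝ)} (hU : IsOpen U)
    {g gbar : (Fin n → ℝ) → Matrix (Fin n) (Fin n) ℝ} (hg : MetricOn U g)
    (hgbar : MetricOn U gbar) (hproj : ProjEquivOn U (LeviCivita g) (LeviCivita gbar))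
    {p : Fin n → ℝ} (hp : p ∈ U) :
    ∃ φ : Fin n → ℝ, ∀ i j k, LeviCivita gbar p i j k - LeviCivita g p i j k
      = (if i = j then φ k else 0) + (if i = k then φ j else 0) :=
  exists_eq_of_forall_apply_self_eq_smul
    (T := fun i j k => LeviCivita gbar p i j k - LeviCivita g p i j k)
    (fun i j k => by rw [leviCivita_symm hU hgbar hp, leviCivita_symm hU hg hp])
    (exists_difference_eq_smul hU (smoothChristoffelOn_leviCivita hU hg) hproj hp)

/-- The function `|r|^c * Q` is stationary where `c * r' * Q + r * Q' = 0`. -/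
theorem hasDerivAt_abs_rpow_mul_zero {r Q : ℝ → ℝ} {r' Q' c t : ℝ} (hr : HasDerivAt r r' t)
    (hQ : HasDerivAt Q Q' t) (h0 : r t ≠ 0) (h : c * r' * Q t + r t * Q' = 0) :
    HasDerivAt (fun s => |r s| ^ c * Q s) 0 t := by
  have h1 : HasDerivAt (fun s => Real.exp (Real.log (r s) * c) * Q s)
      (Real.exp (Real.log (r t) * c) * (r' / r t * c) * Q t
        + Real.exp (Real.log (r t) * c) * Q') t :=
    ((hr.log h0).mul_const c).exp.mul hQ
  have h2 : Real.exp (Real.log (r t) * c) * (r' / r t * c) * Q t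
      + Real.exp (Real.log (r t) * c) * Q' = 0 := by
    field_simp
    linear_combination Real.exp (Real.log (r t) * c) * h
  rw [h2] at h1
  refine h1.congr_of_eventuallyEq ?_
  filter_upwards [hr.continuousAt.eventually_ne h0] with s hs
  rw [Real.rpow_def_of_pos (abs_pos.2 hs), Real.log_abs]

/-- Let `g` and `ḡ` be projectively equivalent pseudo-Riemannian metrics on
an `n`-dimensional domain.  Then `I(ξ) = |det g / det ḡ|^{2/(n+1)} ḡ(ξ,ξ)` is an integral of
the geodesic flow of `g`: along every geodesic `γ` of `g` the function `t ↦ I(γ̇(t))` is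
constant. -/
theorem statement_9 {n : ℕ} (hn : 2 ≤ n) (U : Set (Fin n → ℝ)) (hU : IsOpen U)
    (g gbar : (Fin n → ℝ) → Matrix (Fin n) (Fin n) ℝ)
    (hg : MetricOn U g) (hgbar : MetricOn U gbar)
    (hproj : ProjEquivOn U (LeviCivita g) (LeviCivita gbar))
    (γ : ℝ → Fin n → ℝ) (I : Set ℝ) (hI : IsOpen I) (hIconn : IsPreconnected I)
    (hgeo : IsGeodesicOn U (LeviCivita g) γ I) :
    ∀ t₁ ∈ I, ∀ t₂ ∈ I,
      |(g (γ t₁)).det / (gbar (γ t₁)).det| ^ (2 / ((n : ℝ) + 1))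
          * ∑ i, ∑ j, gbar (γ t₁) i j
              * deriv (fun s => γ s i) t₁ * deriv (fun s => γ s j) t₁
        = |(g (γ t₂)).det / (gbar (γ t₂)).det| ^ (2 / ((n : ℝ) + 1))
          * ∑ i, ∑ j, gbar (γ t₂) i j
              * deriv (fun s => γ s i) t₂ * deriv (fun s => γ s j) t₂ := by
  have key : ∀ t ∈ I, HasDerivAt (fun t => |(g (γ t)).det / (gbar (γ t)).det| ^ (2 / ((n : ℝ) + 1))
      * ∑ i, ∑ j, gbar (γ t) i j * deriv (fun s => γ s i) t * deriv (fun s => γ s j) t) 0 t := by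
    intro t ht
    have hp : γ t ∈ U := hgeo.1 t ht
    obtain ⟨φ, hφ⟩ := exists_leviCivita_sub_eq hU hg hgbar hproj hp
    set v : ℝ → Fin n → ℝ := fun t i => deriv (fun s => γ s i) t with hv
    have h1 : ∀ i, HasDerivAt (fun s => γ s i) (v t i) t := fun i =>
      (((hgeo.2.1 i).differentiableOn (by simp)).differentiableAt (hI.mem_nhds ht)).hasDerivAt
    set c : ℝ := ∑ k, φ k * v t k with hc
    have hdiff : ∀ i, ∑ j, ∑ k, LeviCivita gbar (γ t) i j k * v t j * v t k
        - ∑ j, ∑ k, LeviCivita g (γ t) i j k * v t j * v t k = 2 * c * v t i := fun i => by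
      simp only [← Finset.sum_sub_distrib, ← sub_mul, hφ, add_mul, ite_mul, zero_mul,
        Finset.sum_add_distrib, Finset.sum_ite_irrel, Finset.sum_const_zero, Finset.sum_ite_eq,
        Finset.mem_univ, if_true]
      have e : ∑ k, φ k * v t i * v t k = c * v t i := by
        rw [hc, Finset.sum_mul]
        exact Finset.sum_congr rfl fun k _ => by ring
      rw [e, ← Finset.sum_mul, ← hc]
      ring
    have h2 : ∀ i, HasDerivAt (fun s => v s i)
        (2 * c * v t i - ∑ j, ∑ k, LeviCivita gbar (γ t) i j k * v t j * v t k) t := fun i => by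
      have h := ((((hgeo.2.1 i).deriv_of_isOpen hI (m := ∞) (by simp)).differentiableOn
        (by simp)).differentiableAt (hI.mem_nhds ht)).hasDerivAt
      refine h.congr_deriv ?_
      linear_combination hgeo.2.2 t ht i + hdiff i
    have hQ := hasDerivAt_metric_apply_self hU hgbar hp h1 h2
    have hr := (hasDerivAt_det_metric hU hg hp h1).fun_div (hasDerivAt_det_metric hU hgbar hp h1)
      (hgbar.2.2 _ hp)
    refine hasDerivAt_abs_rpow_mul_zero hr hQ (div_ne_zero (hg.2.2 _ hp) (hgbar.2.2 _ hp)) ?_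
    have htr : ∑ k, (∑ i, LeviCivita gbar (γ t) i i k) * v t k
        - ∑ k, (∑ i, LeviCivita g (γ t) i i k) * v t k = (n + 1) * c := by
      simp only [← Finset.sum_sub_distrib, ← sub_mul, hφ, if_true, Finset.sum_add_distrib,
        Finset.sum_ite_eq', Finset.mem_univ, Finset.sum_const, Finset.card_univ, Fintype.card_fin,
        nsmul_eq_mul]
      rw [hc, Finset.mul_sum]
      exact Finset.sum_congr rfl fun k _ => by ring
    have hQ' : ∑ i, ∑ j, gbar (γ t) i j * (2 * c * v t i) * v t j
        = 2 * c * ∑ i, ∑ j, gbar (γ t) i j * v t i * v t j := by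
      simp only [Finset.mul_sum]
      exact Finset.sum_congr rfl fun i _ => Finset.sum_congr rfl fun j _ => by ring
    have hd := hgbar.2.2 _ hp
    have hn1 : (n : ℝ) + 1 ≠ 0 := by positivity
    rw [hQ', eq_add_of_sub_eq htr]
    field_simp
    ring
  intro t₁ h₁ t₂ h₂
  exact hI.is_const_of_deriv_eq_zero hIconn
    (fun t ht => (key t ht).differentiableAt.differentiableWithinAt)
    (fun t ht => (key t ht).deriv) h₁ h₂

end ProjGeo
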